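/- arXiv:2203.11801 — 5 statements merged into one kernel-verified Lean document; each statement's English description precedes it below -/
import Mathlib

section
/- Let R be a Dedekind domain with field of fractions K, let K' be a finite separable field extension of K, and let R̄ be the integral closure of R in K'. Let y ∈ R̄ be such that K' = K(y), and let f be the minimal polynomial of y over K. Then 𝔣(R̄/R[y]) = f'(y) · 𝒞_{R̄/R}, where 𝔣(R̄/R[y]) := {a ∈ R[y] : a R̄ ⊆ R[y]} is the conductor of R[y] in R̄ and 𝒞_{R̄/R} := {z ∈ K' : Tr_{K'/K}(z r̄) ∈ R for all r̄ ∈ R̄} is the complementary module. -/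
open Pointwise in
/-- Euler's description of the trace dual of `R[y]`, read as a membership criterion for `R[y]`. -/
theorem aeval_derivative_mul_mem_adjoin_iff
    {R K L : Type*} [CommRing R] [IsDomain R] [IsIntegrallyClosed R]
    [Field K] [Algebra R K] [IsFractionRing R K] [Field L] [Algebra K L]
    [FiniteDimensional K L] [Algebra.IsSeparable K L] [Algebra R L] [IsScalarTower R K L]
    {y : L} (hgen : Algebra.adjoin K {y} = ⊤) (hy : IsIntegral R y) (z : L) :
    Polynomial.aeval y (Polynomial.derivative (minpoly K y)) * z ∈ Algebra.adjoin R {y} ↔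
      ∀ s ∈ Algebra.adjoin R {y}, Algebra.trace K L (z * s) ∈ Set.range (algebraMap R K) := by
  have hne : Polynomial.aeval y (Polynomial.derivative (minpoly K y)) ≠ 0 :=
    (Algebra.IsSeparable.isSeparable K y).aeval_derivative_ne_zero (minpoly.aeval _ _)
  have h := SetLike.ext_iff.mp (traceForm_dualSubmodule_adjoin R K hgen hy) z
  rw [Submodule.mem_smul_iff_inv_mul_mem (inv_ne_zero hne), inv_inv,
    Subalgebra.mem_toSubmodule] at h
  rw [← h]
  simp [LinearMap.BilinForm.mem_dualSubmodule, Algebra.traceForm_apply, Submodule.mem_one]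

/-- Let `R` be a Dedekind domain with field of fractions `K`, let `K'` be a
finite separable field extension of `K`, and let `R̄` be the integral closure of
`R` in `K'`.  Let `y ∈ R̄` be such that `K' = K(y)` and let `f` be the minimal
polynomial of `y` over `K`.  Then the conductor
`𝔣(R̄/R[y]) = {a ∈ R[y] : a R̄ ⊆ R[y]}` equals `f'(y) • 𝒞_{R̄/R}` where
`𝒞_{R̄/R} = {z ∈ K' : Tr_{K'/K}(z * r) ∈ R for all r ∈ R̄}` is the
complementary module. -/
theorem conductor_eq_derivative_mul_complementary_module
    (R : Type*) [CommRing R] [IsDedekindDomain R]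
    (K : Type*) [Field K] [Algebra R K] [IsFractionRing R K]
    (K' : Type*) [Field K'] [Algebra K K']
    [FiniteDimensional K K'] [Algebra.IsSeparable K K']
    [Algebra R K'] [IsScalarTower R K K']
    (y : K') (hy : y ∈ integralClosure R K')
    (hgen : Algebra.adjoin K {y} = ⊤) :
    {a : K' | a ∈ Algebra.adjoin R {y} ∧
        ∀ b ∈ integralClosure R K', a * b ∈ Algebra.adjoin R {y}} =
      (fun z : K' =>
          Polynomial.aeval y (Polynomial.derivative (minpoly K y)) * z) ''
        {z : K' | ∀ r ∈ integralClosure R K',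
          Algebra.trace K K' (z * r) ∈ Set.range (algebraMap R K)} := by
  have hne : Polynomial.aeval y (Polynomial.derivative (minpoly K y)) ≠ 0 :=
    (Algebra.IsSeparable.isSeparable K y).aeval_derivative_ne_zero (minpoly.aeval _ _)
  have hmem := aeval_derivative_mul_mem_adjoin_iff (R := R) hgen hy
  have hle : Algebra.adjoin R {y} ≤ integralClosure R K' :=
    Algebra.adjoin_le (Set.singleton_subset_iff.mpr hy)
  ext a
  constructor
  · rintro ⟨-, ha⟩
    refine ⟨(Polynomial.aeval y (Polynomial.derivative (minpoly K y)))⁻¹ * a, fun r hr ↦ ?_,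
      mul_inv_cancel_left₀ hne a⟩
    have hr' := (hmem ((Polynomial.aeval y (Polynomial.derivative (minpoly K y)))⁻¹ *
      (a * r))).mp (by rw [mul_inv_cancel_left₀ hne]; exact ha r hr) 1 (one_mem _)
    rwa [mul_one, ← mul_assoc] at hr'
  · rintro ⟨z, hz, rfl⟩
    refine ⟨(hmem z).mpr fun s hs ↦ hz s (hle hs), fun b hb ↦ ?_⟩
    dsimp only
    rw [mul_assoc, hmem]
    intro s hs
    rw [mul_assoc]
    exact hz _ (mul_mem hb (hle hs))
end

section
/- Let A be a Noetherian reduced commutative ring and let J ⊆ A be an ideal containing a non-zerodivisor a of A. Then the endomorphism ring Hom_A(J, J) of A-linear endomorphisms of J is a commutative ring, and the map A → Hom_A(J, J) sending x ∈ A to the multiplication-by-x endomorphism of J is an injective ring homomorphism. -/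
/-- An endomorphism of an ideal satisfies `x * φ y = y * φ x`. -/
theorem Ideal.mul_end_apply_comm {A : Type*} [CommRing A] {J : Ideal A}
    (φ : Module.End A J) (x y : J) : (x : A) * (φ y : A) = (y : A) * (φ x : A) := by
  have h : (x : A) • y = (y : A) • x := Subtype.ext (mul_comm (x : A) (y : A))
  have h' := congrArg (fun z : J => (φ z : A)) h
  simpa only [map_smul, Submodule.coe_smul, smul_eq_mul] using h'

/-- Let `A` be a Noetherian reduced commutative ring and let `J ⊆ A` be an
ideal containing a non-zerodivisor `a`.  Then the endomorphism ring
`Hom_A(J, J)` is commutative, and the map `A → Hom_A(J, J)` sending `x` to the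
multiplication-by-`x` endomorphism is an injective ring homomorphism. -/
theorem end_of_ideal_commutative_and_injective
    (A : Type*) [CommRing A] [IsNoetherianRing A] [IsReduced A]
    (J : Ideal A) (a : A) (haJ : a ∈ J) (ha : a ∈ nonZeroDivisors A) :
    (∀ φ ψ : Module.End A J, φ * ψ = ψ * φ) ∧
      Function.Injective (algebraMap A (Module.End A J)) := by
  constructor
  · intro φ ψ
    ext x
    have key : ∀ f g : Module.End A J,
        a * (a * (f (g x) : A)) = (x : A) * ((f ⟨a, haJ⟩ : A) * (g ⟨a, haJ⟩ : A)) := by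
      intro f g
      have hf := Ideal.mul_end_apply_comm f ⟨a, haJ⟩ (g x)
      have hg := Ideal.mul_end_apply_comm g ⟨a, haJ⟩ x
      linear_combination a * hf + (f ⟨a, haJ⟩ : A) * hg
    have h : a * (a * (φ (ψ x) : A)) = a * (a * (ψ (φ x) : A)) := by
      rw [key φ ψ, key ψ φ, mul_comm (φ ⟨a, haJ⟩ : A)]
    exact (mul_cancel_left_mem_nonZeroDivisors ha).1
      ((mul_cancel_left_mem_nonZeroDivisors ha).1 h)
  · intro x y hxy
    have h := congrArg (fun f : Module.End A J => (f ⟨a, haJ⟩ : A)) hxy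
    simp only [Module.algebraMap_end_apply, Submodule.coe_smul, smul_eq_mul] at h
    exact (mul_cancel_right_mem_nonZeroDivisors ha).1 h
end

section
/- Let A be a Noetherian reduced commutative ring, let J ⊆ A be an ideal containing a non-zerodivisor a of A, and let Q(A) be the total ring of fractions of A. Then the map Hom_A(J, J) → Q(A) sending an A-linear endomorphism φ of J to φ(a)/a is an injective A-algebra homomorphism whose image is (1/a)·(aJ : J), where aJ : J := {b ∈ A : bJ ⊆ aJ}. In particular, Hom_A(J, J) ≅ (1/a)·(aJ : J) as A-algebras. -/
/-- An endomorphism of an ideal commutes with the multiplications by its elements. -/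
theorem Ideal.end_apply_mul_comm {A : Type*} [CommRing A] {J : Ideal A}
    (φ : Module.End A J) (x y : J) : (φ x : A) * y = x * φ y := by
  have h : y.1 • φ x = x.1 • φ y := by
    rw [← map_smul, ← map_smul]
    congr 1
    ext
    simp [mul_comm]
  simpa [mul_comm] using congrArg Subtype.val h

/-- If `bJ ⊆ aJ` with `a` a non-zerodivisor, then `b / a` acts on `J`. -/
theorem Ideal.exists_end_of_mem_colon {A : Type*} [CommRing A] {J : Ideal A} {a b : A}
    (ha : a ∈ nonZeroDivisors A) (hb : b ∈ (Ideal.span {a} * J).colon (J : Set A)) :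
    ∃ φ : Module.End A J, ∀ x : J, a * (φ x : A) = b * x := by
  have h (x : J) : ∃ z : J, a * (z : A) = b * x := by
    obtain ⟨z, hz, hzx⟩ := Ideal.mem_span_singleton_mul.1 (Submodule.mem_colon.1 hb x x.2)
    exact ⟨⟨z, hz⟩, hzx⟩
  choose f hf using h
  refine ⟨{ toFun := f, map_add' := fun x y => ?_, map_smul' := fun c x => ?_ }, hf⟩
  · ext
    apply (mul_cancel_left_mem_nonZeroDivisors ha).1
    simp [mul_add, hf]
  · ext
    apply (mul_cancel_left_mem_nonZeroDivisors ha).1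
    simp [mul_left_comm a, hf, mul_left_comm b]

/-- Let `A` be a Noetherian reduced commutative ring, `J ⊆ A` an ideal
containing a non-zerodivisor `a`, and `Q(A)` the total ring of fractions of
`A`.  The map `Hom_A(J, J) → Q(A)`, `φ ↦ φ(a)/a`, is an injective `A`-algebra
homomorphism whose image is `(1/a)·(aJ : J)`, where
`aJ : J = {b ∈ A : bJ ⊆ aJ}`. -/
theorem end_of_ideal_embeds_in_total_fraction_ring
    (A : Type*) [CommRing A] [IsNoetherianRing A] [IsReduced A]
    (J : Ideal A) (a : A) (haJ : a ∈ J) (ha : a ∈ nonZeroDivisors A)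
    (g : Module.End A J → FractionRing A)
    (hg : ∀ φ : Module.End A J,
      g φ = IsLocalization.mk' (FractionRing A) ((φ ⟨a, haJ⟩ : J) : A)
        (⟨a, ha⟩ : nonZeroDivisors A)) :
    Function.Injective g ∧
      g 1 = 1 ∧
      (∀ φ ψ : Module.End A J, g (φ * ψ) = g φ * g ψ) ∧
      (∀ φ ψ : Module.End A J, g (φ + ψ) = g φ + g ψ) ∧
      (∀ x : A, g (algebraMap A (Module.End A J) x)
          = algebraMap A (FractionRing A) x) ∧
      Set.range g =
        (fun b : A => IsLocalization.mk' (FractionRing A) b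
            (⟨a, ha⟩ : nonZeroDivisors A)) ''
          ((Ideal.span {a} * J).colon J : Set A) := by
  have mk_eq (b c : A) : IsLocalization.mk' (FractionRing A) b (⟨a, ha⟩ : nonZeroDivisors A) =
      IsLocalization.mk' (FractionRing A) c (⟨a, ha⟩ : nonZeroDivisors A) ↔ b = c := by
    rw [IsLocalization.mk'_eq_iff_eq, (IsFractionRing.injective A (FractionRing A)).eq_iff]
    exact mul_cancel_left_mem_nonZeroDivisors ha
  refine ⟨fun φ ψ h => ?_, ?_, fun φ ψ => ?_, fun φ ψ => ?_, fun x => ?_, ?_⟩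
  · rw [hg, hg, mk_eq] at h
    ext x
    apply (mul_cancel_left_mem_nonZeroDivisors ha).1
    have h₁ := Ideal.end_apply_mul_comm φ ⟨a, haJ⟩ x
    have h₂ := Ideal.end_apply_mul_comm ψ ⟨a, haJ⟩ x
    rw [← h₁, ← h₂, h]
  · rw [hg]
    exact IsLocalization.mk'_self _ ha
  · rw [hg, hg, hg, ← IsLocalization.mk'_mul, IsLocalization.mk'_eq_iff_eq]
    congr 1
    have h := Ideal.end_apply_mul_comm φ ⟨a, haJ⟩ (ψ ⟨a, haJ⟩)
    simp only [Module.End.mul_apply, Submonoid.coe_mul] at h ⊢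
    rw [h, mul_assoc]
  · rw [hg, hg, hg, LinearMap.add_apply, Submodule.coe_add, IsLocalization.mk'_eq_iff_eq_mul,
      add_mul, IsLocalization.mk'_spec, IsLocalization.mk'_spec, map_add]
  · rw [hg, IsLocalization.mk'_eq_iff_eq_mul, ← map_mul]
    simp [Module.algebraMap_end_apply]
  · ext q
    constructor
    · rintro ⟨φ, rfl⟩
      refine ⟨φ ⟨a, haJ⟩, Submodule.mem_colon.2 fun x hx => ?_, (hg φ).symm⟩
      exact Ideal.mem_span_singleton_mul.2
        ⟨φ ⟨x, hx⟩, (φ ⟨x, hx⟩).2, (Ideal.end_apply_mul_comm φ ⟨a, haJ⟩ ⟨x, hx⟩).symm⟩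
    · rintro ⟨b, hb, rfl⟩
      obtain ⟨φ, hφ⟩ := Ideal.exists_end_of_mem_colon ha hb
      refine ⟨φ, (hg φ).trans ((mk_eq _ _).2 ?_)⟩
      apply (mul_cancel_left_mem_nonZeroDivisors ha).1
      rw [hφ, mul_comm]
end

section
/- Let A be a Noetherian integral domain and let J ⊆ A be a nonzero radical ideal such that for every prime ideal 𝔭 of A not containing J, the localization A_𝔭 is integrally closed (i.e., the non-normal locus of A is contained in V(J)). Then A is integrally closed (in its field of fractions) if and only if the natural map A → Hom_A(J, J), sending x ∈ A to multiplication by x, is surjective. -/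
open scoped nonZeroDivisors

/-- An element of the fraction field that is integral over `A` becomes an element of `A` after
multiplication by a power of an ideal `J` outside whose zero locus `A` is normal. -/
theorem exists_pow_smul_mem_one_of_isIntegral
    {A : Type*} [CommRing A] [IsDomain A] [IsNoetherianRing A] {J : Ideal A}
    (hloc : ∀ (𝔭 : Ideal A) (hp : 𝔭.IsPrime), ¬ J ≤ 𝔭 →
      IsIntegrallyClosed (@Localization.AtPrime A _ 𝔭 hp))
    {b : FractionRing A} (hb : IsIntegral A b) :
    ∃ n : ℕ, ∀ f ∈ J ^ n, f • b ∈ (1 : Submodule A (FractionRing A)) := by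
  let D : Ideal A := (1 : Submodule A (FractionRing A)).comap (LinearMap.toSpanSingleton A _ b)
  suffices h : J ≤ D.radical from
    Ideal.exists_pow_le_of_le_radical_of_fg h (IsNoetherian.noetherian J)
  rw [Ideal.radical_eq_sInf]
  refine le_sInf fun p ⟨hDp, hp⟩ => ?_
  by_contra hJp
  have := hloc p hp hJp
  have hle : p.primeCompl ≤ A⁰ := p.primeCompl_le_nonZeroDivisors
  let := IsLocalization.localizationAlgebraOfSubmonoidLe
    (Localization.AtPrime p) (FractionRing A) p.primeCompl A⁰ hle
  have := IsLocalization.localization_isScalarTower_of_submonoid_le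
    (Localization.AtPrime p) (FractionRing A) p.primeCompl A⁰ hle
  have : IsFractionRing (Localization.AtPrime p) (FractionRing A) :=
    IsFractionRing.isFractionRing_of_isDomain_of_isLocalization p.primeCompl _ _
  obtain ⟨y, hy⟩ := IsIntegrallyClosed.isIntegral_iff.mp
    (hb.tower_top (A := Localization.AtPrime p))
  obtain ⟨⟨a, s⟩, has⟩ := IsLocalization.surj p.primeCompl y
  refine s.2 (hDp (Submodule.mem_one.mpr ⟨a, ?_⟩))
  have := congrArg (algebraMap (Localization.AtPrime p) (FractionRing A)) has
  rw [map_mul, hy, ← IsScalarTower.algebraMap_apply, ← IsScalarTower.algebraMap_apply] at this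
  rw [LinearMap.toSpanSingleton_apply, Algebra.smul_def, mul_comm, this]

/-- A finitely generated submodule of integral elements of the fraction field is multiplied into
`A` by a power of an ideal `J` outside whose zero locus `A` is normal. -/
theorem exists_pow_smul_mem_one_of_fg
    {A : Type*} [CommRing A] [IsDomain A] [IsNoetherianRing A] {J : Ideal A}
    (hloc : ∀ (𝔭 : Ideal A) (hp : 𝔭.IsPrime), ¬ J ≤ 𝔭 →
      IsIntegrallyClosed (@Localization.AtPrime A _ 𝔭 hp))
    {N : Submodule A (FractionRing A)} (hN : N.FG) (hint : ∀ b ∈ N, IsIntegral A b) :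
    ∃ n : ℕ, ∀ f ∈ J ^ n, ∀ b ∈ N, f • b ∈ (1 : Submodule A (FractionRing A)) := by
  induction N, hN using Submodule.fg_induction with
  | singleton x =>
    obtain ⟨n, hn⟩ := exists_pow_smul_mem_one_of_isIntegral hloc
      (hint x (Submodule.mem_span_singleton_self x))
    refine ⟨n, fun f hf b hb => ?_⟩
    obtain ⟨a, rfl⟩ := Submodule.mem_span_singleton.mp hb
    rw [smul_comm]
    exact Submodule.smul_mem _ a (hn f hf)
  | sup M₁ M₂ _ _ h₁ h₂ =>
    obtain ⟨n, hn⟩ := h₁ fun b hb => hint b (Submodule.mem_sup_left hb)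
    obtain ⟨m, hm⟩ := h₂ fun b hb => hint b (Submodule.mem_sup_right hb)
    refine ⟨n + m, fun f hf b hb => ?_⟩
    obtain ⟨x, hx, y, hy, rfl⟩ := Submodule.mem_sup.mp hb
    rw [smul_add]
    exact add_mem (hn f (Ideal.pow_le_pow_right (Nat.le_add_right n m) hf) x hx)
      (hm f (Ideal.pow_le_pow_right (Nat.le_add_left m n) hf) y hy)

/-- If every endomorphism of a nonzero ideal `J` is multiplication by an element of `A`, then
every element of the fraction field that multiplies `J` into itself lies in `A`. -/
theorem mem_one_of_smul_mem_of_surjective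
    {A : Type*} [CommRing A] [IsDomain A] {J : Ideal A} (hJ : J ≠ ⊥)
    (hsurj : Function.Surjective (algebraMap A (Module.End A J)))
    {w : FractionRing A} (hw : ∀ j ∈ J, ∃ i ∈ J, algebraMap A (FractionRing A) i = j • w) :
    w ∈ (1 : Submodule A (FractionRing A)) := by
  have hinj := IsFractionRing.injective A (FractionRing A)
  choose g hgJ hg using hw
  let φ : Module.End A J :=
    { toFun := fun j => ⟨g j j.2, hgJ j j.2⟩
      map_add' := fun x y => Subtype.ext <| hinj <| by
        simp [hg, add_smul]
      map_smul' := fun a x => Subtype.ext <| hinj <| by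
        simp only [hg, RingHom.id_apply, SetLike.val_smul, smul_eq_mul, map_mul, mul_smul]
        rw [Algebra.smul_def] }
  obtain ⟨a, ha⟩ := hsurj φ
  obtain ⟨j, hj, hj0⟩ := Submodule.exists_mem_ne_zero_of_ne_bot hJ
  refine Submodule.mem_one.mpr ⟨a, ?_⟩
  have h : a * j = g j hj := congrArg Subtype.val (LinearMap.congr_fun ha ⟨j, hj⟩)
  have h' := hg j hj
  rw [← h, map_mul, Algebra.smul_def, mul_comm] at h'
  exact mul_left_cancel₀ ((map_ne_zero_iff _ hinj).mpr hj0) h'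

/-- Over an integrally closed domain, every endomorphism of a nonzero finitely generated ideal is
multiplication by a ring element. -/
theorem IsIntegrallyClosed.algebraMap_end_ideal_surjective
    {A : Type*} [CommRing A] [IsDomain A] [IsIntegrallyClosed A] {J : Ideal A} (hJ : J ≠ ⊥)
    (hfg : J.FG) : Function.Surjective (algebraMap A (Module.End A J)) := by
  intro φ
  have hinj := IsFractionRing.injective A (FractionRing A)
  obtain ⟨g, hg, hg0⟩ := Submodule.exists_mem_ne_zero_of_ne_bot hJ
  have hg0' : algebraMap A (FractionRing A) g ≠ 0 := (map_ne_zero_iff _ hinj).mpr hg0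
  have hcomm (h : J) : (φ h : A) * g = φ ⟨g, hg⟩ * h := by
    have h₁ : g • h = (h : A) • (⟨g, hg⟩ : J) := Subtype.ext (mul_comm _ _)
    have h₂ := congrArg (fun x => (φ x : A)) h₁
    simp only [map_smul, SetLike.val_smul, smul_eq_mul] at h₂
    rw [mul_comm, h₂, mul_comm]
  set z : FractionRing A :=
    algebraMap A (FractionRing A) (φ ⟨g, hg⟩) / algebraMap A (FractionRing A) g with hz
  have hzφ (h : J) :
      z * algebraMap A (FractionRing A) h = algebraMap A (FractionRing A) (φ h) := by
    rw [hz, div_mul_eq_mul_div, div_eq_iff hg0', ← map_mul, ← map_mul, hcomm]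
  have hint : IsIntegral A z := by
    refine isIntegral_of_smul_mem_submodule (M := FractionRing A)
      (Submodule.map (Algebra.linearMap A (FractionRing A)) J) ?_ (Submodule.FG.map _ hfg) z ?_
    · exact fun h => hg0' <| (Submodule.eq_bot_iff _).mp h _ (Submodule.mem_map_of_mem hg)
    · rintro _ ⟨j, hj, rfl⟩
      exact ⟨φ ⟨j, hj⟩, (φ ⟨j, hj⟩).2, (hzφ ⟨j, hj⟩).symm⟩
  obtain ⟨a, ha⟩ := IsIntegrallyClosed.isIntegral_iff.mp hint
  refine ⟨a, LinearMap.ext fun h => Subtype.ext <| hinj ?_⟩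
  rw [← hzφ h, ← ha, ← map_mul]
  rfl

/-- If every endomorphism of a nonzero radical ideal `J` is multiplication by an element of `A`,
and a power of `J` multiplies a subalgebra `B` of the fraction field into `A`, then `B` is contained
in `A`. -/
theorem mem_one_of_pow_smul_mem_of_surjective
    {A : Type*} [CommRing A] [IsDomain A] {J : Ideal A} (hJ : J ≠ ⊥) (hrad : J.IsRadical)
    (hsurj : Function.Surjective (algebraMap A (Module.End A J)))
    {B : Subalgebra A (FractionRing A)} {n : ℕ}
    (hn : ∀ f ∈ J ^ n, ∀ b ∈ B, f • b ∈ (1 : Submodule A (FractionRing A)))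
    {b : FractionRing A} (hb : b ∈ B) : b ∈ (1 : Submodule A (FractionRing A)) := by
  induction n with
  | zero => simpa using hn 1 (by simp) b hb
  | succ n ih =>
    refine ih fun f hf b hb => mem_one_of_smul_mem_of_surjective hJ hsurj fun j hj => ?_
    have hjf : j * f ∈ J ^ (n + 1) := by
      rw [pow_succ']
      exact Ideal.mul_mem_mul hj hf
    obtain ⟨i, hi⟩ := Submodule.mem_one.mp (hn _ hjf b hb)
    obtain ⟨k, hk⟩ := Submodule.mem_one.mp
      (hn _ hjf (f • (b * b)) (B.smul_mem (B.mul_mem hb hb) f))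
    refine ⟨i, hrad ⟨2, ?_⟩, by rw [hi, mul_smul]⟩
    have : i ^ 2 = j * k := by
      apply IsFractionRing.injective A (FractionRing A)
      rw [map_pow, map_mul, hi, hk]
      simp only [Algebra.smul_def, map_mul]
      ring
    rw [this]
    exact J.mul_mem_right k hj


/-- Let `A` be a Noetherian integral domain and let `J ⊆ A` be a nonzero
radical ideal such that for every prime `𝔭` not containing `J` the localization
`A_𝔭` is integrally closed.  Then `A` is integrally closed if and only if the
natural map `A → Hom_A(J, J)`, sending `x` to multiplication by `x`, is
surjective. -/
theorem grauert_remmert_normality_criterion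
    (A : Type*) [CommRing A] [IsDomain A] [IsNoetherianRing A]
    (J : Ideal A) (hJ : J ≠ ⊥) (hrad : J.IsRadical)
    (hloc : ∀ (𝔭 : Ideal A) (hp : 𝔭.IsPrime), ¬ J ≤ 𝔭 →
      IsIntegrallyClosed (@Localization.AtPrime A _ 𝔭 hp)) :
    IsIntegrallyClosed A ↔
      Function.Surjective (algebraMap A (Module.End A J)) := by
  refine ⟨fun _ => IsIntegrallyClosed.algebraMap_end_ideal_surjective hJ
    (IsNoetherian.noetherian J), fun hsurj => ?_⟩
  refine (isIntegrallyClosed_iff (FractionRing A)).mpr fun {z} hz => ?_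
  obtain ⟨n, hn⟩ := exists_pow_smul_mem_one_of_fg hloc
    (N := Subalgebra.toSubmodule (Algebra.adjoin A {z})) hz.fg_adjoin_singleton
    fun b hb => adjoin_le_integralClosure hz hb
  exact Submodule.mem_one.mp (mem_one_of_pow_smul_mem_of_surjective hJ hrad hsurj hn
    (Algebra.self_mem_adjoin_singleton A z))
end

section
/- Let k be a field, let F_0 ∈ k[X, Y] have total degree D, write x := X mod ⟨F_0⟩ and y := Y mod ⟨F_0⟩ in k[X, Y]/⟨F_0⟩, and assume that not both (∂F_0/∂X)(x, y) and (∂F_0/∂Y)(x, y) are zero in k[X, Y]/⟨F_0⟩. If #k > D + 1, then there exists λ ∈ k^× such that, setting G_λ(X', Y') := F_0(X' + λY', Y'), the leading coefficient of G_λ as a polynomial in Y' over k[X'] is the nonzero constant Σ_{i=0}^{D} c_{i,D−i} λ^i (where c_{i,j} is the coefficient of X^i Y^j in F_0), so deg_{Y'}(G_λ) = D with leading coefficient in k^×, and (∂G_λ/∂Y')(x', y') = λ(∂F_0/∂X)(x' + λy', y') + (∂F_0/∂Y)(x' + λy', y') ≠ 0 in k[X', Y']/⟨G_λ⟩, where x'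 := X' mod ⟨G_λ⟩ and y' := Y' mod ⟨G_λ⟩. -/
open MvPolynomial

section Shear

variable {k : Type*} [Field k]

/-- The substitution `X 0 ↦ X 0 + lam * X 1`, `X 1 ↦ X 1`. -/
noncomputable def shear (lam : k) : MvPolynomial (Fin 2) k →ₐ[k] MvPolynomial (Fin 2) k :=
  bind₁ (fun i : Fin 2 => if i = 0 then X 0 + C lam * X 1 else X 1)

lemma shear_X_zero (lam : k) : shear lam (X 0) = X 0 + C lam * X 1 := by
  simp [shear]

lemma shear_X_one (lam : k) : shear lam (X 1) = X 1 := by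
  simp [shear]

lemma shear_C (lam a : k) : shear lam (C a) = C a := by
  simp [shear]

lemma shear_neg_shear (lam : k) (p : MvPolynomial (Fin 2) k) :
    shear (-lam) (shear lam p) = p := by
  have h : (shear (-lam)).comp (shear lam) = AlgHom.id k _ := by
    ext i : 1
    fin_cases i <;> simp [shear_X_zero, shear_X_one]
  exact DFunLike.congr_fun h p

lemma pderiv_one_shear (lam : k) (p : MvPolynomial (Fin 2) k) :
    pderiv 1 (shear lam p) = C lam * shear lam (pderiv 0 p) + shear lam (pderiv 1 p) := by
  induction p using MvPolynomial.induction_on with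
  | C a => simp
  | add p q hp hq => simp only [map_add, hp, hq]; ring
  | mul_X p i hp =>
    fin_cases i <;>
    simp [hp, shear_X_zero, shear_X_one, pderiv_X] <;> ring

lemma totalDegree_shear_le (lam : k) (p : MvPolynomial (Fin 2) k) :
    (shear lam p).totalDegree ≤ p.totalDegree := by
  have hX (i : Fin 2) : (shear lam (X i)).totalDegree ≤ 1 := by
    fin_cases i
    · simp only [Fin.zero_eta, shear_X_zero]
      refine (totalDegree_add _ _).trans (max_le (totalDegree_X _).le ?_)
      refine (totalDegree_mul _ _).trans ?_
      simp
    · simp [shear_X_one]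
  conv_lhs => rw [p.as_sum, map_sum]
  refine totalDegree_finsetSum_le fun d hd => ?_
  refine le_trans ?_ (le_totalDegree hd)
  rw [monomial_eq, map_mul, shear_C, Finsupp.prod, map_prod]
  refine (totalDegree_mul _ _).trans ?_
  rw [totalDegree_C, zero_add]
  refine (totalDegree_finsetProd _ _).trans (Finset.sum_le_sum fun i _ => ?_)
  rw [map_pow]
  refine (totalDegree_pow _ _).trans ?_
  simpa using Nat.mul_le_mul_left (d i) (hX i)

lemma coeff_single_one_eq (p : MvPolynomial (Fin 2) k) (n : ℕ) :
    coeff (Finsupp.single 1 n) p =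
      (aeval ![(0 : Polynomial k), Polynomial.X] p).coeff n := by
  induction p using MvPolynomial.induction_on' with
  | add p q hp hq => simp [hp, hq]
  | monomial d a =>
    have hd : d = Finsupp.single 1 n ↔ d 0 = 0 ∧ n = d 1 := by
      simp [Finsupp.ext_iff, eq_comm]
    rw [aeval_monomial, coeff_monomial, Finsupp.prod_fintype _ _ (by simp)]
    simp only [hd, Fin.prod_univ_two, Matrix.cons_val_zero, Matrix.cons_val_one,
      Polynomial.algebraMap_eq, Polynomial.coeff_C_mul]
    by_cases h0 : d 0 = 0 <;> simp [h0, Polynomial.coeff_X_pow]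

lemma coeff_single_one_shear (lam : k) (p : MvPolynomial (Fin 2) k) (n : ℕ) :
    coeff (Finsupp.single 1 n) (shear lam p) =
      ∑ i ∈ Finset.range (n + 1),
        coeff (Finsupp.single 0 i + Finsupp.single 1 (n - i)) p * lam ^ i := by
  rw [coeff_single_one_eq]
  induction p using MvPolynomial.induction_on' with
  | add p q hp hq => simp [hp, hq, add_mul, Finset.sum_add_distrib]
  | monomial d a =>
    have hd (i : ℕ) : d = Finsupp.single 0 i + Finsupp.single 1 (n - i) ↔
        i = d 0 ∧ d 1 = n - i := by
      simp [Finsupp.ext_iff, eq_comm]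
    have hX0 : aeval ![(0 : Polynomial k), Polynomial.X] (shear lam (X 0)) =
        Polynomial.C lam * Polynomial.X := by
      simp [shear_X_zero, Polynomial.C_mul']
    have hX1 : aeval ![(0 : Polynomial k), Polynomial.X] (shear lam (X 1)) = Polynomial.X := by
      simp [shear_X_one]
    have hlhs : Polynomial.C a * ((Polynomial.C lam * Polynomial.X) ^ d 0 * Polynomial.X ^ d 1) =
        Polynomial.C (a * lam ^ d 0) * Polynomial.X ^ (d 0 + d 1) := by
      rw [Polynomial.C_mul, Polynomial.C_pow]; ring
    conv_lhs =>
      rw [monomial_eq, Finsupp.prod_fintype _ _ (by simp), Fin.prod_univ_two]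
      simp only [map_mul, map_pow, shear_C, hX0, hX1, aeval_C, Polynomial.algebraMap_eq]
    rw [hlhs, Polynomial.coeff_C_mul_X_pow]
    simp only [coeff_monomial, hd]
    by_cases h : n = d 0 + d 1
    · rw [if_pos h, Finset.sum_eq_single (d 0)]
      · rw [if_pos ⟨rfl, by omega⟩]
      · intro i _ hi
        rw [if_neg fun hh => hi hh.1, zero_mul]
      · intro hi
        rw [Finset.mem_range] at hi
        omega
    · rw [if_neg h, Finset.sum_eq_zero]
      intro i hi
      rw [Finset.mem_range] at hi
      rw [if_neg (by omega), zero_mul]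

/-- The dehomogenization `∑ i, c i (D - i) * T ^ i` of the degree `D` part of a bivariate
polynomial. -/
noncomputable def topPoly (p : MvPolynomial (Fin 2) k) (D : ℕ) : Polynomial k :=
  ∑ i ∈ Finset.range (D + 1),
    Polynomial.monomial i (coeff (Finsupp.single 0 i + Finsupp.single 1 (D - i)) p)

lemma coeff_topPoly (p : MvPolynomial (Fin 2) k) (D i : ℕ) :
    (topPoly p D).coeff i =
      if i ≤ D then coeff (Finsupp.single 0 i + Finsupp.single 1 (D - i)) p else 0 := by
  simp [topPoly, Polynomial.coeff_monomial]

lemma eval_topPoly (p : MvPolynomial (Fin 2) k) (D : ℕ) (lam : k) :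
    (topPoly p D).eval lam = ∑ i ∈ Finset.range (D + 1),
      coeff (Finsupp.single 0 i + Finsupp.single 1 (D - i)) p * lam ^ i := by
  simp [topPoly, Polynomial.eval_finsetSum]

lemma natDegree_topPoly_le (p : MvPolynomial (Fin 2) k) (D : ℕ) :
    (topPoly p D).natDegree ≤ D := by
  rw [Polynomial.natDegree_le_iff_coeff_eq_zero]
  intro i hi
  rw [coeff_topPoly, if_neg (by omega)]

lemma topPoly_totalDegree_ne_zero {p : MvPolynomial (Fin 2) k} (hp : p ≠ 0) :
    topPoly p p.totalDegree ≠ 0 := by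
  obtain ⟨d, hd, hsup⟩ := Finset.exists_mem_eq_sup p.support (by simpa using hp)
    (fun s => s.sum fun _ e => e)
  have hdeg : p.totalDegree = d 0 + d 1 := by
    rw [totalDegree, hsup, Finsupp.sum_fintype _ _ (by simp), Fin.sum_univ_two]
  intro h
  have hc := congrArg (Polynomial.coeff · (d 0)) h
  have hd' : Finsupp.single 0 (d 0) + Finsupp.single 1 (d 1) = d := by
    ext i; fin_cases i <;> simp
  simp [coeff_topPoly, hdeg, hd'] at hc
  exact (mem_support_iff.mp hd) hc

lemma totalDegree_pderiv_lt {p : MvPolynomial (Fin 2) k} (hp : 0 < p.totalDegree) (i : Fin 2) :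
    (pderiv i p).totalDegree < p.totalDegree := by
  rw [totalDegree, Finset.sup_lt_iff hp]
  intro d hd
  have h : d + Finsupp.single i 1 ∈ p.support := by
    rw [mem_support_iff, coeff_pderiv] at hd
    exact mem_support_iff.mpr (left_ne_zero_of_mul hd)
  have := le_totalDegree h
  rw [Finsupp.sum_add_index' (by simp) (by simp), Finsupp.sum_single_index (by simp)] at this
  omega

/-- Euler's identity for the top form when the derivative in the direction `(lam, 1)` vanishes. -/
lemma topPoly_euler {p : MvPolynomial (Fin 2) k} {lam : k} (D : ℕ)
    (h : C lam * pderiv 0 p + pderiv 1 p = 0) :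
    (D : Polynomial k) * topPoly p D =
      (Polynomial.X - Polynomial.C lam) * Polynomial.derivative (topPoly p D) := by
  have hc (i j : ℕ) :
      lam * (coeff (Finsupp.single 0 (i + 1) + Finsupp.single 1 j) p * (i + 1)) +
        coeff (Finsupp.single 0 i + Finsupp.single 1 (j + 1)) p * (j + 1) = 0 := by
    have h' := congrArg (coeff (Finsupp.single 0 i + Finsupp.single 1 j)) h
    rw [coeff_add, coeff_C_mul, coeff_pderiv, coeff_pderiv, coeff_zero, add_right_comm,
      ← Finsupp.single_add, add_assoc, ← Finsupp.single_add] at h'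
    simpa using h'
  ext i
  rw [← Polynomial.C_eq_natCast, Polynomial.coeff_C_mul, sub_mul, Polynomial.coeff_sub,
    Polynomial.coeff_C_mul, Polynomial.coeff_derivative]
  have hX : (Polynomial.X * Polynomial.derivative (topPoly p D)).coeff i =
      (topPoly p D).coeff i * i := by
    cases i with
    | zero => simp
    | succ i => rw [Polynomial.coeff_X_mul, Polynomial.coeff_derivative]; push_cast; rfl
  rw [hX]
  simp only [coeff_topPoly]
  rcases lt_trichotomy i D with hi | rfl | hi
  · obtain ⟨j, rfl⟩ := Nat.exists_eq_add_of_lt hi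
    have h' := hc i j
    rw [if_pos (by omega), if_pos (by omega), show i + j + 1 - i = j + 1 by omega,
      show i + j + 1 - (i + 1) = j by omega]
    push_cast
    linear_combination h'
  · simp [mul_comm]
  · simp [hi.not_ge, show ¬ i + 1 ≤ D by omega]

lemma dvd_pderiv_direction_unique {p : MvPolynomial (Fin 2) k} {a b : k}
    (hnb : ¬ (p ∣ pderiv 0 p ∧ p ∣ pderiv 1 p))
    (ha : p ∣ C a * pderiv 0 p + pderiv 1 p) (hb : p ∣ C b * pderiv 0 p + pderiv 1 p) :
    a = b := by
  by_contra hab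
  refine hnb ?_
  have h0 : p ∣ pderiv 0 p := by
    have h := (dvd_sub ha hb).mul_left (C (a - b)⁻¹)
    have e : C (a - b)⁻¹ * (C a * pderiv 0 p + pderiv 1 p - (C b * pderiv 0 p + pderiv 1 p)) =
        C ((a - b)⁻¹ * (a - b)) * pderiv 0 p := by
      simp only [C_mul, C_sub]; ring
    rwa [e, inv_mul_cancel₀ (sub_ne_zero.mpr hab), C_1, one_mul] at h
  exact ⟨h0, (dvd_add_right (h0.mul_left _)).mp ha⟩

/-- A polynomial of degree at most `n` satisfying Euler's identity for `lam`, for which `lam` is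
not a root, has fewer than `n` distinct roots. -/
lemma card_roots_lt_of_euler [DecidableEq k] {P : Polynomial k} {n : ℕ} {lam : k} (hn : 0 < n)
    (hP : P ≠ 0) (hdeg : P.natDegree ≤ n)
    (he : (n : Polynomial k) * P = (Polynomial.X - Polynomial.C lam) * Polynomial.derivative P)
    (hlam : ¬ P.IsRoot lam) : P.roots.toFinset.card < n := by
  by_contra! hcard
  have h1 := P.roots.toFinset_card_le
  have h2 := P.card_roots'
  have hnodup : P.roots.Nodup := Multiset.toFinset_card_eq_card_iff_nodup.mp (by omega)
  obtain ⟨μ, hμ⟩ := Finset.card_pos.mp (hn.trans_le hcard)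
  have hroot : P.IsRoot μ := Polynomial.isRoot_of_mem_roots (Multiset.mem_toFinset.mp hμ)
  have hμl : μ - lam ≠ 0 := sub_ne_zero.mpr fun h => hlam (h ▸ hroot)
  have hev := congrArg (Polynomial.eval μ) he
  simp only [Polynomial.eval_mul, hroot.eq_zero, mul_zero, Polynomial.eval_sub,
    Polynomial.eval_X, Polynomial.eval_C] at hev
  have hder : (Polynomial.derivative P).IsRoot μ :=
    (mul_eq_zero.mp hev.symm).resolve_left hμl
  have := (Polynomial.one_lt_rootMultiplicity_iff_isRoot hP).mpr ⟨hroot, hder⟩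
  rw [← Polynomial.count_roots] at this
  have := Multiset.nodup_iff_count_le_one.mp hnodup μ
  omega

lemma exists_good_direction (p : MvPolynomial (Fin 2) k)
    (hk : (p.totalDegree : Cardinal) + 1 < Cardinal.mk k)
    (hnb : ¬ (p ∣ pderiv 0 p ∧ p ∣ pderiv 1 p)) :
    ∃ lam : k, lam ≠ 0 ∧ (topPoly p p.totalDegree).eval lam ≠ 0 ∧
      ¬ p ∣ C lam * pderiv 0 p + pderiv 1 p := by
  classical
  have hpos : 0 < p.totalDegree := by
    by_contra! h
    rw [Nat.le_zero, totalDegree_eq_zero_iff_eq_C] at h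
    refine hnb ?_
    rw [h]
    simp
  have hp : p ≠ 0 := by rintro rfl; simp at hpos
  set P := topPoly p p.totalDegree with hPdef
  have hP : P ≠ 0 := topPoly_totalDegree_ne_zero hp
  have hPdeg : P.natDegree ≤ p.totalDegree := natDegree_topPoly_le p _
  have hroots : P.roots.toFinset.card ≤ p.totalDegree :=
    P.roots.toFinset_card_le.trans (P.card_roots'.trans hPdeg)
  obtain ⟨B, hBcard, h0, hBroot, hBdvd⟩ : ∃ B : Finset k, B.card ≤ p.totalDegree + 1 ∧ 0 ∈ B ∧
      (∀ lam, P.eval lam = 0 → lam ∈ B) ∧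
      ∀ lam, p ∣ C lam * pderiv 0 p + pderiv 1 p → lam ∈ B := by
    have hmem (lam : k) (h : P.eval lam = 0) : lam ∈ P.roots.toFinset := by
      simpa [hP] using h
    by_cases hex : ∃ a, p ∣ C a * pderiv 0 p + pderiv 1 p ∧ ¬ P.IsRoot a
    · obtain ⟨a, ha, har⟩ := hex
      have hzero : C a * pderiv 0 p + pderiv 1 p = 0 := by
        by_contra hne
        obtain ⟨q, hq⟩ := ha
        have hq0 : q ≠ 0 := by rintro rfl; simp_all
        have h1 : (C a * pderiv 0 p + pderiv 1 p).totalDegree < p.totalDegree := by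
          refine (totalDegree_add _ _).trans_lt (max_lt ?_ (totalDegree_pderiv_lt hpos 1))
          refine (totalDegree_mul _ _).trans_lt ?_
          simpa using totalDegree_pderiv_lt hpos 0
        rw [hq, totalDegree_mul_of_isDomain hp hq0] at h1
        omega
      have hlt := card_roots_lt_of_euler hpos hP hPdeg (topPoly_euler _ hzero) har
      refine ⟨insert 0 (insert a P.roots.toFinset), ?_, by simp, fun lam h => ?_, fun lam h => ?_⟩
      · have h1 := Finset.card_insert_le 0 (insert a P.roots.toFinset)
        have h2 := Finset.card_insert_le a P.roots.toFinset
        omega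
      · exact Finset.mem_insert_of_mem (Finset.mem_insert_of_mem (hmem lam h))
      · simp [dvd_pderiv_direction_unique hnb h ha]
    · push Not at hex
      refine ⟨insert 0 P.roots.toFinset, ?_, by simp, fun lam h => ?_, fun lam h => ?_⟩
      · exact (Finset.card_insert_le _ _).trans (by omega)
      · exact Finset.mem_insert_of_mem (hmem lam h)
      · exact Finset.mem_insert_of_mem (hmem lam (hex lam h))
  obtain ⟨lam, hlam⟩ : ∃ lam, lam ∉ B := by
    by_contra! h
    have hB : (B : Set k) = Set.univ := Set.eq_univ_of_forall h
    have hcard : Cardinal.mk k = B.card := by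
      rw [← Cardinal.mk_univ, ← hB]
      exact Cardinal.mk_coe_finset
    rw [hcard] at hk
    have : p.totalDegree + 1 < B.card := by exact_mod_cast hk
    omega
  exact ⟨lam, fun h => hlam (h ▸ h0), fun h => hlam (hBroot lam h), fun h => hlam (hBdvd lam h)⟩

end Shear


/-- Let `k` be a field, `F₀ ∈ k[X, Y]` of total degree `D`, with not both
partial derivatives vanishing in `k[X, Y]/⟨F₀⟩`.  If `#k > D + 1`, then there
is `λ ∈ k^×` such that, with `G_λ(X', Y') := F₀(X' + λY', Y')`, the leading
coefficient of `G_λ` in `Y'` is the nonzero constant `∑ i ≤ D, c_{i,D−i} λ^i`,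
`deg_{Y'} G_λ = D`, and
`∂G_λ/∂Y' = λ·(∂F₀/∂X)(X' + λY', Y') + (∂F₀/∂Y)(X' + λY', Y')` is nonzero in
`k[X', Y']/⟨G_λ⟩`. -/
theorem good_linear_coordinate_change_exists
    (k : Type*) [Field k] (F₀ : MvPolynomial (Fin 2) k)
    (D : ℕ) (hD : D = F₀.totalDegree)
    (hk : (D : Cardinal) + 1 < Cardinal.mk k)
    (hnb : ¬ (Ideal.Quotient.mk (Ideal.span {F₀}) (pderiv (0 : Fin 2) F₀) = 0 ∧
        Ideal.Quotient.mk (Ideal.span {F₀}) (pderiv (1 : Fin 2) F₀) = 0)) :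
    ∃ lam : k, lam ≠ 0 ∧
      ∀ G : MvPolynomial (Fin 2) k,
        G = bind₁ (fun i : Fin 2 => if i = 0 then X 0 + C lam * X 1 else X 1) F₀ →
          coeff (Finsupp.single (1 : Fin 2) D) G =
              ∑ i ∈ Finset.range (D + 1),
                coeff (Finsupp.single (0 : Fin 2) i +
                  Finsupp.single (1 : Fin 2) (D - i)) F₀ * lam ^ i ∧
            (∑ i ∈ Finset.range (D + 1),
                coeff (Finsupp.single (0 : Fin 2) i +
                  Finsupp.single (1 : Fin 2) (D - i)) F₀ * lam ^ i) ≠ 0 ∧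
            degreeOf 1 G = D ∧
            (∀ d ∈ G.support, d 1 = D → d = Finsupp.single (1 : Fin 2) D) ∧
            pderiv (1 : Fin 2) G =
              C lam * bind₁ (fun i : Fin 2 =>
                  if i = 0 then X 0 + C lam * X 1 else X 1) (pderiv (0 : Fin 2) F₀) +
                bind₁ (fun i : Fin 2 =>
                  if i = 0 then X 0 + C lam * X 1 else X 1) (pderiv (1 : Fin 2) F₀) ∧
            Ideal.Quotient.mk (Ideal.span {G}) (pderiv (1 : Fin 2) G) ≠ 0 := by
  subst hD
  simp only [Ideal.Quotient.eq_zero_iff_dvd] at hnb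
  obtain ⟨lam, hlam, hne, hndvd⟩ := exists_good_direction F₀ hk hnb
  refine ⟨lam, hlam, ?_⟩
  rintro G hG
  replace hG : G = shear lam F₀ := hG
  rw [eval_topPoly] at hne
  have hcoeff : coeff (Finsupp.single (1 : Fin 2) F₀.totalDegree) G = _ :=
    hG ▸ coeff_single_one_shear lam F₀ F₀.totalDegree
  have hder : pderiv 1 G = _ := hG ▸ pderiv_one_shear lam F₀
  have htot : G.totalDegree ≤ F₀.totalDegree := hG ▸ totalDegree_shear_le lam F₀
  refine ⟨hcoeff, hne, le_antisymm ((degreeOf_le_totalDegree G 1).trans htot) ?_, ?_, hder, ?_⟩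
  · have hmem : Finsupp.single (1 : Fin 2) F₀.totalDegree ∈ G.support := by
      rw [mem_support_iff, hcoeff]
      exact hne
    simpa using monomial_le_degreeOf 1 hmem
  · intro d hd hd1
    have h := (le_totalDegree hd).trans htot
    rw [Finsupp.sum_fintype _ _ (by simp), Fin.sum_univ_two] at h
    ext i
    fin_cases i
    · simp; omega
    · simpa using hd1
  · rw [Ne, Ideal.Quotient.eq_zero_iff_dvd]
    intro h
    have h' := map_dvd (shear (-lam)) h
    rw [hder, hG, map_add, map_mul, shear_C] at h'
    simp only [shear_neg_shear] at h'
    exact hndvd h'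
end
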